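/- Let R = k[x_1,…,x_d] and let φ = [Φ₁; Φ₂] be an n×(n−1) matrix with a = 3, where Φ₁ is 3×(n−1) with entries of degree ε₁ and Φ₂ is (n−3)×(n−1) with entries of degree ε₂, I = I_{n−1}(φ) has height 2, and J is the ideal generated by the 3 maximal minors of φ fixing the rows of Φ₂. If ht I_{n−3}(Φ₂) = 3, then the symmetric algebra Sym_R(J) is a Cohen–Macaulay S-module of dimension d+1, where S = R[T_1,T_2,T_3], with minimal graded free resolution 0 → S(−((n−3)ε₂+2ε₁+2)) ⊕ S(−((n−2)ε₂+ε₁+1))^{n−3} → S(−((n−3)ε₂+ε₁+1))^{n−1} → S → Sym_R(J) → 0; in fact the presentation ideal I₁(T·Φ₁·θ) of Sym_R(J) is a perfect height-2 ideal generated by the (n−2)-minors of the (n−1)×(n−2) matrix [(T·Φ₁)ᵗ | Φ₂ᵗ]. -/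

import Mathlib

set_option synthInstance.maxHeartbeats 1000000
set_option maxHeartbeats 1000000

open Matrix MvPolynomial

noncomputable section

def idealHeight {A : Type*} [CommRing A] (I : Ideal A) : ℕ∞ :=
  ⨅ (P : PrimeSpectrum A) (_ : I ≤ P.asIdeal), Order.height P

def minorsIdeal {A : Type*} [CommRing A] {p q : ℕ} (t : ℕ)
    (M : Matrix (Fin p) (Fin q) A) : Ideal A :=
  Ideal.span { x | ∃ (r : Fin t → Fin p) (c : Fin t → Fin q),
    Function.Injective r ∧ Function.Injective c ∧ x = (M.submatrix r c).det }

/-- Condition `G_s` of Artin–Nagata: for every prime `P ⊇ L` with `ht P ≤ s − 1`,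
the localization `L_P` can be generated by at most `ht P` elements. -/
def CondG {A : Type*} [CommRing A] (L : Ideal A) (s : ℕ) : Prop :=
  ∀ P : Ideal A, P.IsPrime → L ≤ P → idealHeight P + 1 ≤ (s : ℕ∞) →
    ∃ c : ℕ, (c : ℕ∞) ≤ idealHeight P ∧ ∃ g : Fin c → A, (∀ i, g i ∈ L) ∧
      ∀ x ∈ L, ∃ u ∉ P, u * x ∈ Ideal.span (Set.range g)

/-- The skew-symmetric matrix of signed `m × m` minors (obtained by omitting two columns)
of an `m × (m+2)` matrix; this is the middle differential of the Buchsbaum–Rim complex. -/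
def bbrim {A : Type*} [CommRing A] {m : ℕ} (ψ : Matrix (Fin m) (Fin (m + 2)) A) :
    Matrix (Fin (m + 2)) (Fin (m + 2)) A :=
  Matrix.of fun i j =>
    if h : (i : ℕ) < (j : ℕ) then
      (-1) ^ ((i : ℕ) + (j : ℕ)) *
        (ψ.submatrix id (fun q => j.succAbove
          ((⟨(i : ℕ), by have := j.isLt; omega⟩ : Fin (m + 1)).succAbove q))).det
    else if h' : (j : ℕ) < (i : ℕ) then
      (-1) ^ ((i : ℕ) + (j : ℕ) + 1) *
        (ψ.submatrix id (fun q => i.succAbove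
          ((⟨(j : ℕ), by have := i.isLt; omega⟩ : Fin (m + 1)).succAbove q))).det
    else 0

def rowMap {A : Type*} [CommRing A] {ι : Type*} [Fintype ι] (g : ι → A) :
    (ι → A) →ₗ[A] A :=
  ∑ i, g i • LinearMap.proj i

/-- Data of a (necessarily minimal) graded free resolution
`0 → ⊕_j R(−a_j) → ⊕_i R(−b_i) → I → 0` of an ideal of a polynomial ring. -/
def HasResolutionData {A : Type*} [CommRing A] {σ : Type*} (I : Ideal (MvPolynomial σ A))
    {N M : ℕ} (b : Fin N → ℕ) (a : Fin M → ℕ) : Prop :=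
  ∃ (g : Fin N → MvPolynomial σ A) (φ : Matrix (Fin N) (Fin M) (MvPolynomial σ A)),
    (∀ i, (g i).IsHomogeneous (b i)) ∧ Ideal.span (Set.range g) = I ∧
    (∀ i j, (φ i j).IsHomogeneous (a j - b i) ∧ (a j ≤ b i → φ i j = 0)) ∧
    Function.Injective φ.mulVecLin ∧
    LinearMap.range φ.mulVecLin = LinearMap.ker (rowMap g)

/-- The Castelnuovo–Mumford regularity of a codimension-two perfect ideal, read off from
its minimal graded free resolution `0 → ⊕_j R(−a_j) → ⊕_i R(−b_i) → I → 0` as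
`max(max_i b_i, max_j a_j − 1)`. -/
def HasRegularity {A : Type*} [CommRing A] {σ : Type*} (I : Ideal (MvPolynomial σ A))
    (r : ℕ) : Prop :=
  ∃ (N M : ℕ) (b : Fin N → ℕ) (a : Fin M → ℕ), HasResolutionData I b a ∧
    (Finset.univ.sup b) ⊔ ((Finset.univ.sup a) - 1) = r

def IsCohenMacaulayRing (A : Type*) [CommRing A] : Prop :=
  ∀ P : Ideal A, P.IsMaximal → ∃ rs : List A,
    (∀ x ∈ rs, x ∈ P) ∧ RingTheory.Sequence.IsRegular A rs ∧
      (rs.length : ℕ∞) = idealHeight P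

def reesPresentation {A : Type*} [CommRing A] {n : ℕ} (f : Fin n → A) :
    MvPolynomial (Fin n) A →ₐ[A] Polynomial A :=
  MvPolynomial.aeval fun i => Polynomial.C (f i) * Polynomial.X

def Ideal.IsLinearType {A : Type*} [CommRing A] (I : Ideal A) : Prop :=
  ∀ (n : ℕ) (f : Fin n → A), Ideal.span (Set.range f) = I →
    RingHom.ker (reesPresentation f) =
      Ideal.span {p | p ∈ RingHom.ker (reesPresentation f) ∧ p.IsHomogeneous 1}

def moduleDepth {A : Type*} [CommRing A] (J : Ideal A) (M : Type*)
    [AddCommGroup M] [Module A M] : ℕ∞ :=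
  sSup {c : ℕ∞ | ∃ rs : List A, (∀ x ∈ rs, x ∈ J) ∧
    RingTheory.Sequence.IsRegular M rs ∧ (rs.length : ℕ∞) = c}

def analyticSpread {A : Type*} [CommRing A] (m I : Ideal A) : WithBot ℕ∞ :=
  ringKrullDim ((reesAlgebra I) ⧸ (Ideal.map (algebraMap A (reesAlgebra I)) m))

section Points

variable {k : Type*} [Field k]

def gradedPiece (I : Ideal (MvPolynomial (Fin 3) k)) (t : ℕ) :
    Submodule k (MvPolynomial (Fin 3) k) :=
  Submodule.restrictScalars k I ⊓ homogeneousSubmodule (Fin 3) k t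

def pointIdeal (p : Fin 3 → k) : Ideal (MvPolynomial (Fin 3) k) :=
  Ideal.span {f | f.IsHomogeneous 1 ∧ MvPolynomial.eval p f = 0}

def vanishingIdeal {n : ℕ} (pts : Fin n → (Fin 3 → k)) : Ideal (MvPolynomial (Fin 3) k) :=
  ⨅ i, pointIdeal (pts i)

def oneTimesPiece (I : Ideal (MvPolynomial (Fin 3) k)) (s : ℕ) :
    Submodule k (MvPolynomial (Fin 3) k) :=
  Submodule.span k {g | ∃ ℓ f, ℓ ∈ homogeneousSubmodule (Fin 3) k 1 ∧
    f ∈ gradedPiece I s ∧ g = ℓ * f}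

def IsPointFamily {n : ℕ} (pts : Fin n → (Fin 3 → k)) : Prop :=
  (∀ i, pts i ≠ 0) ∧ ∀ i j, i ≠ j → ∀ c : k, pts i ≠ c • pts j

def InGenericPosition {n : ℕ} (pts : Fin n → (Fin 3 → k)) : Prop :=
  ∀ t : ℕ, Module.finrank k (gradedPiece (vanishingIdeal pts) t) = (t + 2).choose 2 - n

def InUniformPosition {n : ℕ} (pts : Fin n → (Fin 3 → k)) : Prop :=
  ∀ T : Finset (Fin n), ∀ t : ℕ,
    Module.finrank k (gradedPiece (⨅ i ∈ T, pointIdeal (pts i)) t) = (t + 2).choose 2 - T.card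

def HasInitialDegree (I : Ideal (MvPolynomial (Fin 3) k)) (s : ℕ) : Prop :=
  gradedPiece I s ≠ ⊥ ∧ ∀ t < s, gradedPiece I t = ⊥

def InTightGenericPosition {n : ℕ} (pts : Fin n → (Fin 3 → k)) (s : ℕ) : Prop :=
  InGenericPosition pts ∧
    Module.finrank k (oneTimesPiece (vanishingIdeal pts) s) =
      min (3 * Module.finrank k (gradedPiece (vanishingIdeal pts) s))
        (Module.finrank k (gradedPiece (vanishingIdeal pts) (s + 1)))

def IsBirationalOntoImage {N : ℕ} (f : Fin N → MvPolynomial (Fin 3) k) : Prop :=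
  ∃ (e : ℕ) (G : Fin 3 → MvPolynomial (Fin N) k) (w : MvPolynomial (Fin 3) k),
    w ≠ 0 ∧ (∀ j, (G j).IsHomogeneous e) ∧
      ∀ j, MvPolynomial.aeval f (G j) = w * MvPolynomial.X j

end Points

end

section ExtVanishing

open CategoryTheory CategoryTheory.Abelian RingTheory.Sequence

universe u

variable {A : Type u} [CommRing A]

/-- The groups `Ext^i(N, M)` vanish for all `i < n`. -/
def ExtVanishesBelow (N M : ModuleCat.{u} A) (n : ℕ) : Prop :=
  ∀ i < n, ∀ e : Ext N M i, e = 0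

variable {N : ModuleCat.{u} A}

theorem ExtVanishesBelow.right_of_shortExact {S : ShortComplex (ModuleCat.{u} A)}
    (hS : S.ShortExact) {n : ℕ} (h₁ : ExtVanishesBelow N S.X₁ (n + 1))
    (h₂ : ExtVanishesBelow N S.X₂ n) : ExtVanishesBelow N S.X₃ n := by
  intro i hi e
  obtain ⟨e', rfl⟩ := Ext.covariant_sequence_exact₃ N hS e rfl (h₁ _ (by omega) _)
  rw [h₂ i hi e', Ext.zero_comp]

theorem ExtVanishesBelow.left_of_shortExact {S : ShortComplex (ModuleCat.{u} A)}
    (hS : S.ShortExact) {n : ℕ}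
    (hf : ∀ (i : ℕ) (e : Ext N S.X₁ i), e.comp (Ext.mk₀ S.f) (add_zero i) = 0)
    (h : ExtVanishesBelow N S.X₃ n) : ExtVanishesBelow N S.X₁ (n + 1) := by
  intro i hi e
  cases i with
  | zero =>
    have := hS.mono_f
    obtain ⟨f, rfl⟩ := (Ext.mk₀_bijective N S.X₁).2 e
    have h0 := hf 0 (Ext.mk₀ f)
    rw [Ext.mk₀_comp_mk₀, Ext.mk₀_eq_zero_iff] at h0
    rw [Ext.mk₀_eq_zero_iff]
    exact (cancel_mono S.f).1 (h0.trans Limits.zero_comp.symm)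
  | succ i =>
    obtain ⟨e', rfl⟩ := Ext.covariant_sequence_exact₁ N hS e (hf _ e) rfl
    rw [h i (by omega) e', Ext.zero_comp]

theorem ExtVanishesBelow.quotSMulTop {M : ModuleCat.{u} A} {x : A} (hx : IsSMulRegular M x)
    {n : ℕ} (h : ExtVanishesBelow N M (n + 1)) :
    ExtVanishesBelow N (ModuleCat.of A (QuotSMulTop x M)) n :=
  ExtVanishesBelow.right_of_shortExact hx.smulShortComplex_shortExact h fun i hi =>
    h i (by omega)

theorem ExtVanishesBelow.of_quotSMulTop {M : ModuleCat.{u} A} {x : A}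
    (hx : IsSMulRegular M x) (hN : x ∈ Module.annihilator A N) {n : ℕ}
    (h : ExtVanishesBelow N (ModuleCat.of A (QuotSMulTop x M)) n) :
    ExtVanishesBelow N M (n + 1) := by
  have hsmul : ∀ (i : ℕ) (e : Ext N M i),
      e.comp (Ext.mk₀ (M.smulShortComplex x).f) (add_zero i) = 0 := by
    intro i e
    have h0 : x • 𝟙 N = 0 :=
      ModuleCat.hom_ext (LinearMap.ext fun y => Module.mem_annihilator.mp hN y)
    have : e.comp (Ext.mk₀ (x • 𝟙 M)) (add_zero i) =
        (Ext.mk₀ (x • 𝟙 N)).comp e (zero_add i) := by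
      rw [Ext.mk₀_smul, Ext.mk₀_smul, Ext.comp_smul, Ext.smul_comp, Ext.comp_mk₀_id,
        Ext.mk₀_id_comp]
    rw [h0, Ext.mk₀_zero, Ext.zero_comp] at this
    exact this
  exact ExtVanishesBelow.left_of_shortExact hx.smulShortComplex_shortExact hsmul h

theorem ExtVanishesBelow.of_isWeaklyRegular {rs : List A}
    (hrs : ∀ x ∈ rs, x ∈ Module.annihilator A N) {M : ModuleCat.{u} A}
    (h : IsWeaklyRegular M rs) : ExtVanishesBelow N M rs.length := by
  induction rs generalizing M with
  | nil => intro i hi; simp at hi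
  | cons x rs ih =>
    rw [isWeaklyRegular_cons_iff] at h
    exact ExtVanishesBelow.of_quotSMulTop h.1 (hrs x (by simp))
      (ih (fun y hy => hrs y (by simp [hy])) (M := ModuleCat.of A (QuotSMulTop x M)) h.2)

theorem ExtVanishesBelow.exists_isWeaklyRegular [IsNoetherianRing A] [Module.Finite A N] {n : ℕ}
    {M : ModuleCat.{u} A} [Module.Finite A M] (h : ExtVanishesBelow N M n) :
    ∃ rs : List A, (∀ x ∈ rs, x ∈ Module.annihilator A N) ∧ rs.length = n ∧
      IsWeaklyRegular M rs := by
  induction n generalizing M with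
  | zero => exact ⟨[], by simp, rfl, IsWeaklyRegular.nil A M⟩
  | succ n ih =>
    have hsub : Subsingleton (N →ₗ[A] M) := by
      refine ⟨fun f g => ?_⟩
      have := (h 0 (by omega) (Ext.mk₀ (ModuleCat.ofHom f))).trans
        (h 0 (by omega) (Ext.mk₀ (ModuleCat.ofHom g))).symm
      exact congrArg ModuleCat.Hom.hom ((Ext.mk₀_bijective N M).1 this)
    obtain ⟨x, hx, hreg⟩ := IsSMulRegular.subsingleton_linearMap_iff.1 hsub
    obtain ⟨rs, hrs, hlen, hw⟩ := ih (M := ModuleCat.of A (QuotSMulTop x M))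
      (ExtVanishesBelow.quotSMulTop hreg h)
    refine ⟨x :: rs, ?_, by simp [hlen], ?_⟩
    · simpa [hx] using hrs
    · exact (isWeaklyRegular_cons_iff M x rs).2 ⟨hreg, hw⟩

theorem RingTheory.Sequence.IsWeaklyRegular.pi {rs : List A} (h : IsWeaklyRegular A rs) (m : ℕ) :
    IsWeaklyRegular (Fin m → A) rs :=
  ((TensorProduct.lid A (Fin m → A)).isWeaklyRegular_congr rs).1
    (h.isWeaklyRegular_rTensor (M₂ := Fin m → A))

/-- If the ideal `K` has a free resolution of length one, then an `A`-regular sequence of length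
`n + 2` in `I` produces an `A ⧸ K`-regular sequence of length `n` in `I`. -/
theorem exists_isWeaklyRegular_quotient [IsNoetherianRing A] {K I : Ideal A} {m l n : ℕ}
    (f : (Fin m → A) →ₗ[A] (Fin l → A)) (g : (Fin l → A) →ₗ[A] A)
    (hf : Function.Injective f) (hfg : LinearMap.range f = LinearMap.ker g)
    (hg : LinearMap.range g = K) {rs : List A} (hrs : ∀ x ∈ rs, x ∈ I)
    (hlen : rs.length = n + 2) (hreg : IsWeaklyRegular A rs) :
    ∃ ss : List A, (∀ x ∈ ss, x ∈ I) ∧ ss.length = n ∧ IsWeaklyRegular (A ⧸ K) ss := by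
  let N : ModuleCat.{u} A := ModuleCat.of A (A ⧸ I)
  have hann : Module.annihilator A N = I := Ideal.annihilator_quotient
  rw [← hann] at hrs
  have hfree : ∀ j : ℕ, ExtVanishesBelow N (ModuleCat.of A (Fin j → A)) (n + 2) := fun j =>
    hlen ▸ ExtVanishesBelow.of_isWeaklyRegular hrs (hreg.pi j)
  have hring : ExtVanishesBelow N (ModuleCat.of A A) (n + 2) :=
    hlen ▸ ExtVanishesBelow.of_isWeaklyRegular hrs hreg
  have hmem : ∀ x, g x ∈ K := fun x => hg ▸ LinearMap.mem_range_self g x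
  let g' : (Fin l → A) →ₗ[A] K := g.codRestrict K hmem
  have hg' : Function.Surjective g' := by
    rintro ⟨y, hy⟩
    obtain ⟨x, rfl⟩ := hg.symm ▸ hy
    exact ⟨x, rfl⟩
  have hexact : Function.Exact f g' := by
    rw [LinearMap.exact_iff, hfg]
    exact LinearMap.ker_codRestrict _ _ _
  have hexact' : Function.Exact K.subtype (Submodule.mkQ K) := by
    rw [LinearMap.exact_iff]; simp
  have h₁ : (ModuleCat.shortComplexOfCompEqZero f g' hexact.linearMap_comp_eq_zero).ShortExact :=
    { exact := ModuleCat.shortComplex_exact _ hexact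
      mono_f := (ModuleCat.mono_iff_injective _).2 hf
      epi_g := (ModuleCat.epi_iff_surjective _).2 hg' }
  have h₂ : (ModuleCat.shortComplexOfCompEqZero K.subtype (Submodule.mkQ K)
      hexact'.linearMap_comp_eq_zero).ShortExact :=
    { exact := ModuleCat.shortComplex_exact _ hexact'
      mono_f := (ModuleCat.mono_iff_injective _).2 K.injective_subtype
      epi_g := (ModuleCat.epi_iff_surjective _).2 K.mkQ_surjective }
  have hK : ExtVanishesBelow N (ModuleCat.of A K) (n + 1) :=
    ExtVanishesBelow.right_of_shortExact h₁ (hfree m) fun i hi => hfree l i (by omega)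
  have hQ : ExtVanishesBelow N (ModuleCat.of A (A ⧸ K)) n :=
    ExtVanishesBelow.right_of_shortExact h₂ hK fun i hi => hring i (by omega)
  obtain ⟨ss, hss, hl, hw⟩ := hQ.exists_isWeaklyRegular
  exact ⟨ss, fun x hx => hann ▸ hss x hx, hl, hw⟩

end ExtVanishing

section MaximalRegularSequences

open RingTheory.Sequence

universe u

/-- Every maximal ideal of the Jacobson ring `A` contains a weakly regular sequence of
length `n`. -/
def HasMaximalRegularSequences (A : Type*) [CommRing A] (n : ℕ) : Prop :=
  IsJacobsonRing A ∧ ∀ m : Ideal A, m.IsMaximal →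
    ∃ rs : List A, (∀ x ∈ rs, x ∈ m) ∧ rs.length = n ∧ IsWeaklyRegular A rs

variable {A B : Type*} [CommRing A] [CommRing B] {n : ℕ}

theorem HasMaximalRegularSequences.of_ringEquiv (e : A ≃+* B)
    (h : HasMaximalRegularSequences A n) : HasMaximalRegularSequences B n := by
  refine ⟨(isJacobsonRing_iso e).1 h.1, fun m hm => ?_⟩
  obtain ⟨rs, hrs, hlen, hreg⟩ := h.2 (m.comap e) (Ideal.comap_isMaximal_of_equiv e)
  refine ⟨rs.map e, ?_, by simpa using hlen, ?_⟩
  · simpa using hrs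
  · let := RingHomInvPair.of_ringEquiv e
    let := RingHomInvPair.symm (↑e : A →+* B) (↑e.symm)
    exact (LinearEquiv.isWeaklyRegular_congr' (σ := (e : A →+* B)) (σ' := (e.symm : B →+* A))
      e.toSemilinearEquiv rs).1 hreg

theorem Polynomial.Monic.mem_map_C_of_mul_mem {J : Ideal A} {f g : Polynomial A} (hf : f.Monic)
    (h : f * g ∈ J.map Polynomial.C) : g ∈ J.map Polynomial.C := by
  rw [← Ideal.mk_ker (I := J), ← Polynomial.ker_mapRingHom, RingHom.mem_ker,
    Polynomial.coe_mapRingHom] at h ⊢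
  rw [Polynomial.map_mul] at h
  exact (hf.map (Ideal.Quotient.mk J)).isRegular.left.mul_left_eq_zero_iff.1 h

theorem HasMaximalRegularSequences.polynomial (h : HasMaximalRegularSequences A n) :
    HasMaximalRegularSequences (Polynomial A) (n + 1) := by
  have := h.1
  refine ⟨inferInstance, fun m hm => ?_⟩
  obtain ⟨rs, hrs, hlen, hreg⟩ := h.2 _ (Polynomial.isMaximal_comap_C_of_isJacobsonRing m)
  let := Ideal.Quotient.field m
  obtain ⟨f, hf, hfm⟩ := Polynomial.comp_C_integral_of_surjective_of_isJacobsonRing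
    (Ideal.Quotient.mk m) Ideal.Quotient.mk_surjective (Ideal.Quotient.mk m Polynomial.X)
  rw [← Polynomial.hom_eval₂, Polynomial.eval₂_C_X, Ideal.Quotient.eq_zero_iff_mem] at hfm
  refine ⟨rs.map Polynomial.C ++ [f], ?_, by simp [hlen], ?_⟩
  · intro x hx
    rcases List.mem_append.1 hx with hx | hx
    · obtain ⟨y, hy, rfl⟩ := List.mem_map.1 hx
      exact hrs y hy
    · rwa [List.mem_singleton.1 hx]
  · rw [isWeaklyRegular_append_iff, isWeaklyRegular_singleton_iff]
    refine ⟨IsWeaklyRegular.of_flat hreg, ?_⟩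
    rw [isSMulRegular_iff_right_eq_zero_of_smul]
    intro x hx
    obtain ⟨g, rfl⟩ := Submodule.mkQ_surjective _ x
    rw [← map_smul, Submodule.mkQ_apply, Submodule.Quotient.mk_eq_zero, smul_eq_mul] at hx
    rw [Submodule.mkQ_apply, Submodule.Quotient.mk_eq_zero]
    rw [smul_eq_mul, Ideal.mul_top, ← Ideal.map_ofList] at hx ⊢
    exact hf.mem_map_C_of_mul_mem hx

theorem HasMaximalRegularSequences.mvPolynomial (h : HasMaximalRegularSequences A n) (m : ℕ) :
    HasMaximalRegularSequences (MvPolynomial (Fin m) A) (n + m) := by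
  induction m with
  | zero => exact h.of_ringEquiv (MvPolynomial.isEmptyRingEquiv A (Fin 0)).symm
  | succ m ih => exact ih.polynomial.of_ringEquiv (finSuccEquiv A m).symm.toRingEquiv

theorem HasMaximalRegularSequences.of_field (k : Type*) [Field k] :
    HasMaximalRegularSequences k 0 :=
  ⟨inferInstance, fun _ _ => ⟨[], by simp, rfl, IsWeaklyRegular.nil k k⟩⟩

end MaximalRegularSequences

section Heights

open RingTheory.Sequence

theorem idealHeight_eq_height {A : Type*} [CommRing A] (I : Ideal A) :
    idealHeight I = I.height := by
  refine le_antisymm ?_ ?_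
  · rw [Ideal.height_eq_inf_minimalPrimes]
    refine le_iInf₂ fun J hJ => ?_
    have hJ' : J.IsPrime := hJ.isPrime
    exact (iInf₂_le (⟨J, hJ'⟩ : PrimeSpectrum A) hJ.1.2).trans
      (PrimeSpectrum.height_eq_orderHeight ⟨J, hJ'⟩).ge
  · refine le_iInf₂ fun P hP => ?_
    rw [← PrimeSpectrum.height_eq_orderHeight]
    exact Ideal.height_mono hP

theorem Ideal.le_height_of_forall_isPrime {A : Type*} [CommRing A] {I : Ideal A} {c : ℕ∞}
    (h : ∀ P : Ideal A, P.IsPrime → I ≤ P → c ≤ P.height) : c ≤ I.height := by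
  rw [Ideal.height_eq_inf_minimalPrimes]
  exact le_iInf₂ fun J hJ => h J (hJ.isPrime) hJ.1.2

variable {A : Type*} [CommRing A]

theorem RingTheory.Sequence.IsWeaklyRegular.length_le_height [IsNoetherianRing A] {rs : List A}
    (h : IsWeaklyRegular A rs) {P : Ideal A} [P.IsPrime] (hrs : ∀ x ∈ rs, x ∈ P) :
    (rs.length : ℕ∞) ≤ P.height := by
  have hreg := h.isRegular_of_isLocalization_of_mem (Localization.AtPrime P) P hrs
  have := ringKrullDim_add_length_eq_ringKrullDim_of_isRegular _ hreg
  rw [IsLocalization.AtPrime.ringKrullDim_eq_height P (Localization.AtPrime P),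
    List.length_map] at this
  have hne : Nontrivial (Localization.AtPrime P ⧸
      Ideal.ofList (rs.map (algebraMap A (Localization.AtPrime P)))) :=
    Ideal.Quotient.nontrivial_iff.2 (by simpa using hreg.top_ne_smul.symm)
  have h0 := ringKrullDim_nonneg_of_nontrivial (R := Localization.AtPrime P ⧸
      Ideal.ofList (rs.map (algebraMap A (Localization.AtPrime P))))
  have : (rs.length : WithBot ℕ∞) ≤ P.height := by
    rw [← this]
    exact le_add_of_nonneg_left h0
  exact_mod_cast this

theorem Ideal.height_add_le_height_comap_mk [IsNoetherianRing A] {K : Ideal A} {c : ℕ∞}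
    (hc : c ≤ K.height) (n : ℕ) (P : Ideal (A ⧸ K)) [P.IsPrime] (hn : n ≤ P.height) :
    n + c ≤ (P.comap (Ideal.Quotient.mk K)).height := by
  induction n generalizing P with
  | zero =>
    have : K ≤ P.comap (Ideal.Quotient.mk K) := by
      conv_lhs => rw [← Ideal.mk_ker (I := K)]
      exact Ideal.ker_le_comap _
    simpa using hc.trans (Ideal.height_mono this)
  | succ n ih =>
    have : ¬ P.height ≤ n := fun h => by
      have := hn.trans h
      norm_cast at this
      omega
    rw [Ideal.height_le_iff] at this
    push Not at this
    obtain ⟨q, hq, hqP, hle⟩ := this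
    have h1 := ih q hle
    have hlt : q.comap (Ideal.Quotient.mk K) < P.comap (Ideal.Quotient.mk K) :=
      (Ideal.comap_mono hqP.le).lt_of_ne fun h =>
        hqP.ne (Ideal.comap_injective_of_surjective _ Ideal.Quotient.mk_surjective h)
    have h2 := Ideal.height_add_one_le_of_lt_of_isPrime hlt
    calc ((n + 1 : ℕ) : ℕ∞) + c = (n + c) + 1 := by push_cast; ring
      _ ≤ _ := by gcongr
      _ ≤ _ := h2

/-- A proper ideal `K` of height at least two with a free resolution of length two of `A ⧸ K`
has height exactly two, and the quotient is Cohen–Macaulay. -/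
theorem isCohenMacaulayRing_quotient_of_free_resolution {A : Type*} [CommRing A]
    [IsNoetherianRing A] {K : Ideal A} {m l n : ℕ}
    (hA : HasMaximalRegularSequences A (n + 2)) (hdim : ringKrullDim A = (n + 2 : ℕ))
    (hK : K ≠ ⊤) (hht : 2 ≤ K.height)
    (f : (Fin m → A) →ₗ[A] (Fin l → A)) (g : (Fin l → A) →ₗ[A] A)
    (hf : Function.Injective f) (hfg : LinearMap.range f = LinearMap.ker g)
    (hg : LinearMap.range g = K) :
    K.height = 2 ∧ IsCohenMacaulayRing (A ⧸ K) ∧ ringKrullDim (A ⧸ K) = (n : WithBot ℕ∞) := by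
  have hle : ∀ P : Ideal A, P.IsPrime → P.height ≤ (n + 2 : ℕ) := fun P hP => by
    have := Ideal.height_le_ringKrullDim_of_isPrime (I := P)
    rw [hdim] at this
    exact WithBot.coe_le_coe.1 this
  have key : ∀ P : Ideal (A ⧸ K), P.IsMaximal → P.height = n ∧
      ∃ rs : List (A ⧸ K), (∀ x ∈ rs, x ∈ P) ∧ IsRegular (A ⧸ K) rs ∧ rs.length = n := by
    intro P hP
    have hm : (P.comap (Ideal.Quotient.mk K)).IsMaximal :=
      Ideal.comap_isMaximal_of_surjective _ Ideal.Quotient.mk_surjective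
    obtain ⟨rs, hrs, hlen, hreg⟩ := hA.2 _ hm
    obtain ⟨ss, hss, hlen', hreg'⟩ := exists_isWeaklyRegular_quotient f g hf hfg hg hrs hlen hreg
    rw [← isWeaklyRegular_map_algebraMap_iff (A ⧸ K)] at hreg'
    have hmem : ∀ x ∈ ss.map (algebraMap A (A ⧸ K)), x ∈ P := by
      intro x hx
      obtain ⟨y, hy, rfl⟩ := List.mem_map.1 hx
      exact hss y hy
    have hlow := hreg'.length_le_height hmem
    rw [List.length_map, hlen'] at hlow
    refine ⟨le_antisymm ?_ hlow, _, hmem, ⟨hreg', ?_⟩, by simpa using hlen'⟩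
    · by_contra! hlt
      have h1 : ((n + 1 : ℕ) : ℕ∞) ≤ P.height := by
        push_cast; exact Order.add_one_le_of_lt hlt
      have h2 := (Ideal.height_add_le_height_comap_mk hht (n + 1) P h1).trans
        (hle _ hm.isPrime)
      norm_cast at h2
      omega
    · intro h
      refine hP.ne_top (top_le_iff.1 ?_)
      rw [h, smul_eq_mul, Ideal.mul_top]
      exact Ideal.span_le.2 hmem
  have hnt : Nontrivial (A ⧸ K) := Ideal.Quotient.nontrivial_iff.2 hK
  obtain ⟨M, hM⟩ := Ideal.exists_maximal (A ⧸ K)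
  refine ⟨le_antisymm ?_ hht, fun P hP => ?_, le_antisymm ?_ ?_⟩
  · by_contra! hlt
    have h3 : ((3 : ℕ) : ℕ∞) ≤ K.height := by
      have := Order.add_one_le_of_lt hlt
      norm_num at this ⊢
      exact this
    have h2 := (Ideal.height_add_le_height_comap_mk h3 n M (key M hM).1.ge).trans
      (hle _ (Ideal.comap_isMaximal_of_surjective _ Ideal.Quotient.mk_surjective).isPrime)
    norm_cast at h2
    omega
  · obtain ⟨h1, rs, h2, h3, h4⟩ := key P hP
    exact ⟨rs, h2, h3, by rw [idealHeight_eq_height, h1, h4]⟩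
  · rw [ringKrullDim_le_iff_isMaximal_height_le]
    intro P hP
    rw [(key P hP).1]
    rfl
  · have := Ideal.height_le_ringKrullDim_of_isPrime (I := M)
    rwa [(key M hM).1] at this

end Heights

section HilbertBurch

/-- The signed maximal minors of a matrix with one more row than columns. -/
def signedMinors {A : Type*} [CommRing A] {q : ℕ} (B : Matrix (Fin (q + 1)) (Fin q) A) :
    Fin (q + 1) → A :=
  fun j => (-1) ^ (j : ℕ) * (B.submatrix j.succAbove id).det

theorem rowMap_apply {A : Type*} [CommRing A] {ι : Type*} [Fintype ι] (g x : ι → A) :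
    rowMap g x = ∑ i, g i * x i := by
  simp [rowMap]

theorem range_rowMap {A : Type*} [CommRing A] {ι : Type*} [Fintype ι] (g : ι → A) :
    LinearMap.range (rowMap g) = Ideal.span (Set.range g) := by
  ext y
  rw [LinearMap.mem_range, Ideal.mem_span_range_iff_exists_fun]
  simp only [rowMap_apply, mul_comm]

variable {A : Type*} [CommRing A] {q : ℕ} (B : Matrix (Fin (q + 1)) (Fin q) A)

theorem signedMinors_map {A' : Type*} [CommRing A'] (f : A →+* A') :
    signedMinors (B.map f) = fun j => f (signedMinors B j) := by
  ext j
  simp only [signedMinors, map_mul, map_pow, map_neg, map_one, RingHom.map_det]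
  rfl

theorem sum_signedMinors_mul_col (c : Fin q) : ∑ j, signedMinors B j * B j c = 0 := by
  have h := Matrix.det_succ_column_zero (Matrix.of fun r => Fin.cons (B r c) (B r) :
    Matrix (Fin (q + 1)) (Fin (q + 1)) A)
  rw [Matrix.det_zero_of_column_eq (Fin.succ_ne_zero c).symm (fun r => by simp)] at h
  rw [h]
  refine Finset.sum_congr rfl fun j _ => ?_
  simp only [signedMinors, Matrix.of_apply, Fin.cons_zero]
  rw [mul_right_comm]
  congr 3

theorem rowMap_signedMinors_mulVec (x : Fin q → A) :
    rowMap (signedMinors B) (B *ᵥ x) = 0 := by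
  have h : signedMinors B ᵥ* B = 0 := funext fun c => sum_signedMinors_mul_col B c
  rw [rowMap_apply]
  change signedMinors B ⬝ᵥ (B *ᵥ x) = 0
  rw [Matrix.dotProduct_mulVec, h, zero_dotProduct]

theorem mulVec_eq_zero_of_signedMinors_ne_zero [IsDomain A] {j : Fin (q + 1)}
    (hj : signedMinors B j ≠ 0) {x : Fin q → A} (hx : B *ᵥ x = 0) : x = 0 := by
  refine Matrix.eq_zero_of_mulVec_eq_zero (right_ne_zero_of_mul hj) (funext fun i => ?_)
  exact congrFun hx (j.succAbove i)

theorem signedMinors_smul_mem_range [IsDomain A] {w : Fin (q + 1) → A}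
    (hw : rowMap (signedMinors B) w = 0) (j : Fin (q + 1)) :
    signedMinors B j • w ∈ LinearMap.range B.mulVecLin := by
  by_cases hj : signedMinors B j = 0
  · rw [hj, zero_smul]; exact zero_mem _
  set D := B.submatrix j.succAbove id
  set x := (-1 : A) ^ (j : ℕ) • (D.adjugate *ᵥ (w ∘ j.succAbove))
  have hx : D *ᵥ x = signedMinors B j • (w ∘ j.succAbove) := by
    rw [Matrix.mulVec_smul, Matrix.mulVec_mulVec, Matrix.mul_adjugate, Matrix.smul_mulVec,
      Matrix.one_mulVec, smul_smul]
    rfl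
  have hx' : ∀ i, (B *ᵥ x) (j.succAbove i) = signedMinors B j * w (j.succAbove i) :=
    fun i => congrFun hx i
  refine ⟨x, funext fun i => ?_⟩
  rcases Fin.eq_self_or_eq_succAbove j i with rfl | ⟨i, rfl⟩
  · have h1 := rowMap_signedMinors_mulVec B x
    have h2 : signedMinors B i * rowMap (signedMinors B) w = 0 := by rw [hw, mul_zero]
    rw [rowMap_apply, Fin.sum_univ_succAbove _ i] at h1 h2
    rw [mul_add, Finset.mul_sum] at h2
    apply mul_left_cancel₀ hj
    simp only [hx', mulVecLin_apply, Pi.smul_apply, smul_eq_mul] at h1 ⊢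
    have h3 : ∀ i' : Fin q, signedMinors B i * (signedMinors B (i.succAbove i') *
        w (i.succAbove i')) = signedMinors B (i.succAbove i') *
          (signedMinors B i * w (i.succAbove i')) := fun i' => by ring
    simp only [h3] at h2
    linear_combination h1 - h2
  · exact hx' i

theorem mem_range_of_prime_smul_mem_range [IsDomain A] {π : A} (hπ : Prime π) {j : Fin (q + 1)}
    (hj : ¬ π ∣ signedMinors B j) {w : Fin (q + 1) → A}
    (hw : π • w ∈ LinearMap.range B.mulVecLin) : w ∈ LinearMap.range B.mulVecLin := by
  obtain ⟨x, hx⟩ := hw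
  have hP : (Ideal.span {π}).IsPrime := (Ideal.span_singleton_prime hπ.ne_zero).2 hπ
  let f := Ideal.Quotient.mk (Ideal.span {π})
  have hj' : signedMinors (B.map f) j ≠ 0 := by
    rw [signedMinors_map]
    exact fun h => hj (Ideal.mem_span_singleton.1 (Ideal.Quotient.eq_zero_iff_mem.1 h))
  have hfx : B.map f *ᵥ (f ∘ x) = 0 := by
    ext i
    rw [← RingHom.map_mulVec]
    have := congrFun hx i
    rw [mulVecLin_apply] at this
    rw [this]
    exact Ideal.Quotient.eq_zero_iff_mem.2
      (Ideal.mem_span_singleton.2 (Dvd.intro _ rfl))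
  have h0 := mulVec_eq_zero_of_signedMinors_ne_zero _ hj' hfx
  have hdvd : ∀ i, π ∣ x i := fun i =>
    Ideal.mem_span_singleton.1 (Ideal.Quotient.eq_zero_iff_mem.1 (congrFun h0 i))
  choose y hy using hdvd
  have hxy : x = π • y := funext hy
  refine ⟨y, funext fun i => mul_left_cancel₀ hπ.ne_zero ?_⟩
  rw [hxy, map_smul] at hx
  exact congrFun hx i

variable [IsDomain A]

theorem mulVecLin_injective_of_signedMinors_ne_zero {j : Fin (q + 1)}
    (hj : signedMinors B j ≠ 0) : Function.Injective B.mulVecLin := by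
  rw [← LinearMap.ker_eq_bot, LinearMap.ker_eq_bot']
  exact fun x hx => mulVec_eq_zero_of_signedMinors_ne_zero B hj hx

/-- The Hilbert–Burch complex of a matrix over a factorial domain is exact as soon as its
maximal minors have no common prime factor. -/
theorem range_mulVecLin_eq_ker_rowMap [UniqueFactorizationMonoid A] {j : Fin (q + 1)}
    (hj : signedMinors B j ≠ 0) (h : ∀ π : A, Prime π → ∃ j, ¬ π ∣ signedMinors B j) :
    LinearMap.range B.mulVecLin = LinearMap.ker (rowMap (signedMinors B)) := by
  refine le_antisymm ?_ fun w hw => ?_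
  · rintro _ ⟨x, rfl⟩
    exact rowMap_signedMinors_mulVec B x
  · have key : ∀ a : A, a ≠ 0 → a • w ∈ LinearMap.range B.mulVecLin →
        w ∈ LinearMap.range B.mulVecLin := by
      intro a
      induction a using UniqueFactorizationMonoid.induction_on_prime with
      | h₁ => exact fun h => absurd rfl h
      | h₂ u hu =>
        intro _ hw
        obtain ⟨u, rfl⟩ := hu
        exact (Submodule.smul_mem_iff_of_isUnit _ u.isUnit).1 hw
      | h₃ a π ha hπ ih =>
        intro _ hw
        rw [mul_smul] at hw
        obtain ⟨j, hj⟩ := h π hπ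
        exact ih ha (mem_range_of_prime_smul_mem_range B hπ hj hw)
    exact key _ hj (signedMinors_smul_mem_range B hw j)

end HilbertBurch

section BuchsbaumRim

variable {A : Type*} [CommRing A] {m : ℕ}

theorem bbrim_self (ψ : Matrix (Fin m) (Fin (m + 2)) A) (j : Fin (m + 2)) :
    bbrim ψ j j = 0 := by
  simp [bbrim]

theorem bbrim_antisymm (ψ : Matrix (Fin m) (Fin (m + 2)) A) (i j : Fin (m + 2)) :
    bbrim ψ i j = -bbrim ψ j i := by
  rcases lt_trichotomy (i : ℕ) j with h | h | h
  · simp only [bbrim, Matrix.of_apply, dif_pos h, dif_neg h.le.not_gt]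
    ring
  · rw [Fin.ext h, bbrim_self, neg_zero]
  · simp only [bbrim, Matrix.of_apply, dif_pos h, dif_neg h.le.not_gt]
    ring

theorem bbrim_succAbove (ψ : Matrix (Fin m) (Fin (m + 2)) A) (j : Fin (m + 2))
    (q : Fin (m + 1)) :
    bbrim ψ (j.succAbove q) j = (-1) ^ ((j : ℕ) + q) *
      (ψ.submatrix id (j.succAbove ∘ q.succAbove)).det := by
  rcases lt_or_ge q.castSucc j with h | h
  · have hlt : ((j.succAbove q : Fin (m + 2)) : ℕ) < j := by
      rw [Fin.succAbove_of_castSucc_lt _ _ h]; exact h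
    simp only [bbrim, Matrix.of_apply, dif_pos hlt]
    simp only [Fin.succAbove_of_castSucc_lt _ _ h, Fin.val_castSucc, Fin.eta, add_comm (q : ℕ)]
    rfl
  · have hlt : (j : ℕ) < (j.succAbove q : Fin (m + 2)) := by
      rw [Fin.succAbove_of_le_castSucc _ _ h]
      exact Nat.lt_succ_of_le h
    simp only [bbrim, Matrix.of_apply, dif_neg hlt.le.not_gt, dif_pos hlt]
    simp only [Fin.succAbove_of_le_castSucc _ _ h, Fin.val_succ]
    have h' : (j : ℕ) ≤ q := h
    congr 1
    · ring
    · congr 2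
      ext r
      simp only [Fin.succAbove, Fin.lt_def, Function.comp]
      split_ifs <;> simp_all <;> omega

theorem bbrim_map {A' : Type*} [CommRing A'] (f : A →+* A')
    (ψ : Matrix (Fin m) (Fin (m + 2)) A) : bbrim (ψ.map f) = (bbrim ψ).map f := by
  ext i j
  by_cases h : i = j
  · rw [h, Matrix.map_apply, bbrim_self, bbrim_self, map_zero]
  · obtain ⟨q, rfl⟩ := Fin.exists_succAbove_eq h
    rw [Matrix.map_apply, bbrim_succAbove, bbrim_succAbove, map_mul, map_pow, map_neg, map_one,
      RingHom.map_det]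
    rfl

theorem sum_mul_bbrim (a : Fin (m + 2) → A) (ψ : Matrix (Fin m) (Fin (m + 2)) A)
    (j : Fin (m + 2)) :
    ∑ l, a l * bbrim ψ l j = (-1) ^ (j : ℕ) *
      ((Matrix.of (Fin.cons a ψ : Fin (m + 1) → Fin (m + 2) → A)).submatrix
        id j.succAbove).det := by
  rw [Matrix.det_succ_row_zero, Fin.sum_univ_succAbove _ j, bbrim_self, mul_zero, zero_add,
    Finset.mul_sum]
  refine Finset.sum_congr rfl fun q _ => ?_
  rw [bbrim_succAbove, pow_add]
  change _ = (-1) ^ (j : ℕ) * ((-1) ^ (q : ℕ) * a (j.succAbove q) *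
    (ψ.submatrix id (j.succAbove ∘ q.succAbove)).det)
  ring

theorem mul_bbrim_self (ψ : Matrix (Fin m) (Fin (m + 2)) A) : ψ * bbrim ψ = 0 := by
  ext i j
  rw [Matrix.mul_apply, sum_mul_bbrim, Matrix.det_zero_of_row_eq (Fin.succ_ne_zero i).symm,
    mul_zero]
  · rfl
  · rfl

theorem signedMinors_transpose_cons (a : Fin (m + 2) → A)
    (ψ : Matrix (Fin m) (Fin (m + 2)) A) (j : Fin (m + 2)) :
    signedMinors (Matrix.of (Fin.cons a ψ : Fin (m + 1) → Fin (m + 2) → A))ᵀ j =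
      ∑ l, a l * bbrim ψ l j := by
  rw [sum_mul_bbrim, signedMinors, ← Matrix.det_transpose, Matrix.transpose_submatrix,
    Matrix.transpose_transpose]

theorem Fin.exists_eq_succAbove_comp {n l : ℕ} (hl : l ≤ n) {c : Fin l → Fin (n + 1)}
    (hc : Function.Injective c) :
    ∃ (j : Fin (n + 1)) (c' : Fin l → Fin n), Function.Injective c' ∧ c = j.succAbove ∘ c' := by
  obtain ⟨j, hj⟩ : ∃ j, j ∉ Set.range c := by
    by_contra! h
    have := Fintype.card_le_of_surjective c h
    simp only [Fintype.card_fin] at this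
    omega
  have h : ∀ i, ∃ i', j.succAbove i' = c i := fun i =>
    Fin.exists_succAbove_eq fun hi => hj ⟨i, hi⟩
  choose c' hc' using h
  exact ⟨j, c', fun x y hxy => hc (by rw [← hc', ← hc', hxy]), funext fun i => (hc' i).symm⟩

theorem Fin.exists_eq_succAbove_comp_perm {n : ℕ} {c : Fin n → Fin (n + 1)}
    (hc : Function.Injective c) :
    ∃ (j : Fin (n + 1)) (σ : Equiv.Perm (Fin n)), c = j.succAbove ∘ σ := by
  obtain ⟨j, c', hc', rfl⟩ := Fin.exists_eq_succAbove_comp le_rfl hc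
  exact ⟨j, Equiv.ofBijective c' (Finite.injective_iff_bijective.1 hc'), rfl⟩

theorem minorsIdeal_eq_span_signedMinors {q : ℕ} (B : Matrix (Fin (q + 1)) (Fin q) A) :
    minorsIdeal q B = Ideal.span (Set.range (signedMinors B)) := by
  refine le_antisymm (Ideal.span_le.2 ?_) (Ideal.span_le.2 ?_)
  · rintro _ ⟨r, c, hr, hc, rfl⟩
    obtain ⟨j, σ, rfl⟩ := Fin.exists_eq_succAbove_comp_perm hr
    have hc' : Function.Bijective c := Finite.injective_iff_bijective.1 hc
    have h : B.submatrix (j.succAbove ∘ σ) c =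
        ((B.submatrix j.succAbove id).submatrix id (Equiv.ofBijective c hc')).submatrix σ id :=
      rfl
    have hj : (B.submatrix j.succAbove id).det = (-1) ^ (j : ℕ) * signedMinors B j := by
      rw [signedMinors, ← mul_assoc, ← mul_pow]; simp
    rw [h, SetLike.mem_coe, Matrix.det_permute, Matrix.det_permute', hj]
    exact Ideal.mul_mem_left _ _ (Ideal.mul_mem_left _ _ (Ideal.mul_mem_left _ _
      (Ideal.subset_span ⟨j, rfl⟩)))
  · rintro _ ⟨j, rfl⟩
    exact Ideal.mul_mem_left _ _ (Ideal.subset_span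
      ⟨j.succAbove, id, Fin.succAbove_right_injective, Function.injective_id, rfl⟩)

theorem exists_bbrim_notMem {ψ : Matrix (Fin m) (Fin (m + 2)) A} {P : Ideal A}
    (h : ¬ minorsIdeal m ψ ≤ P) : ∃ i j, bbrim ψ i j ∉ P := by
  contrapose! h
  refine Ideal.span_le.2 ?_
  rintro _ ⟨r, c, hr, hc, rfl⟩
  obtain ⟨j, c, hinj, rfl⟩ := Fin.exists_eq_succAbove_comp (Nat.le_succ m) hc
  obtain ⟨q, σ, rfl⟩ := Fin.exists_eq_succAbove_comp_perm hinj
  have hr' : Function.Bijective r := Finite.injective_iff_bijective.1 hr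
  have hdet : (ψ.submatrix id (j.succAbove ∘ q.succAbove)).det =
      (-1) ^ ((j : ℕ) + q) * bbrim ψ (j.succAbove q) j := by
    rw [bbrim_succAbove, ← mul_assoc, ← mul_pow]; simp
  have hsub : ψ.submatrix r (j.succAbove ∘ q.succAbove ∘ σ) =
      ((ψ.submatrix id (j.succAbove ∘ q.succAbove)).submatrix (Equiv.ofBijective r hr')
        id).submatrix id σ := rfl
  rw [hsub, SetLike.mem_coe, Matrix.det_permute', Matrix.det_permute, hdet]
  exact Ideal.mul_mem_left _ _ (Ideal.mul_mem_left _ _ (Ideal.mul_mem_left _ _ (h _ _)))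

end BuchsbaumRim

section CommonFactor

theorem bbrim_eq_zero_of_rank_one {D : Type*} [CommRing D] [IsDomain D] {ι : Type*} {m : ℕ}
    {Φ₁ : Matrix ι (Fin (m + 2)) D} {Φ₂ : Matrix (Fin m) (Fin (m + 2)) D}
    (hinj : ∀ x, Φ₁ *ᵥ x = 0 → Φ₂ *ᵥ x = 0 → x = 0) {γ : Fin (m + 2) → D} {δ : ι → D}
    (hM : ∀ i j, (Φ₁ * bbrim Φ₂) i j = γ j * δ i) : bbrim Φ₂ = 0 := by
  have h₁ : ∀ j, Φ₁ *ᵥ (bbrim Φ₂).col j = γ j • δ := fun j => funext fun i => hM i j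
  have h₂ : ∀ j, Φ₂ *ᵥ (bbrim Φ₂).col j = 0 := fun j =>
    funext fun i => congrFun (congrFun (mul_bbrim_self Φ₂) i) j
  by_contra hne
  obtain ⟨i, j, hij⟩ : ∃ i j, bbrim Φ₂ i j ≠ 0 := by
    by_contra! h
    exact hne (Matrix.ext h)
  have hu := hinj (γ j • (bbrim Φ₂).col i - γ i • (bbrim Φ₂).col j)
    (by rw [Matrix.mulVec_sub, Matrix.mulVec_smul, Matrix.mulVec_smul, h₁, h₁, smul_smul,
      smul_smul, mul_comm, sub_self])
    (by rw [Matrix.mulVec_sub, Matrix.mulVec_smul, Matrix.mulVec_smul, h₂, h₂, smul_zero,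
      smul_zero, sub_zero])
  have hγ : γ i = 0 := by
    have := congrFun hu i
    simpa [Matrix.col, bbrim_self, hij] using this
  have hc := hinj ((bbrim Φ₂).col i) (by rw [h₁, hγ, zero_smul]) (h₂ i)
  apply hij
  rw [bbrim_antisymm, neg_eq_zero]
  exact congrFun hc j

theorem mulVec_eq_zero_of_minor_ne_zero {D : Type*} [CommRing D] [IsDomain D] {s q : ℕ}
    {M : Matrix (Fin s) (Fin q) D} {r : Fin q → Fin s} {c : Fin q → Fin q}
    (hc : Function.Injective c) (hdet : (M.submatrix r c).det ≠ 0) {x : Fin q → D}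
    (hx : M *ᵥ x = 0) : x = 0 := by
  have hc' : Function.Bijective c := Finite.injective_iff_bijective.1 hc
  have h : x ∘ c = 0 := by
    refine Matrix.eq_zero_of_mulVec_eq_zero hdet ?_
    have := Matrix.submatrix_mulVec_equiv M (x ∘ c) r (Equiv.ofBijective c hc')
    have hxc : (x ∘ c) ∘ (Equiv.ofBijective c hc').symm = x := funext fun i =>
      congrArg x ((Equiv.ofBijective c hc').apply_symm_apply i)
    rw [hxc, hx] at this
    exact this
  exact funext fun i => by
    obtain ⟨i, rfl⟩ := hc'.2 i
    exact congrFun h i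

variable {R σ : Type*} [CommRing R] [Fintype σ]

theorem MvPolynomial.coeff_sum_X_mul_C [DecidableEq σ] (a : σ → R) (i : σ) :
    (∑ l, X l * C (a l) : MvPolynomial σ R).coeff (Finsupp.single i 1) = a i := by
  rw [coeff_sum, Finset.sum_eq_single i]
  · rw [mul_comm, coeff_C_mul, coeff_X, if_pos rfl, mul_one]
  · intro l _ hl
    rw [mul_comm, coeff_C_mul, coeff_single_X, if_neg (by simp [hl]), mul_zero]
  · simp

theorem MvPolynomial.totalDegree_sum_X_mul_C_le (a : σ → R) :
    (∑ l, X l * C (a l) : MvPolynomial σ R).totalDegree ≤ 1 := by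
  refine totalDegree_finsetSum_le fun l _ => ?_
  exact (totalDegree_mul _ _).trans (by
    rw [totalDegree_C, add_zero]
    exact (totalDegree_monomial_le _ _).trans (by simp))

theorem exists_rank_one_of_dvd [IsDomain R] {ι : Type*} (M : Matrix σ ι R) {π : MvPolynomial σ R}
    (h : ∀ j, π ∣ ∑ l, X l * C (M l j)) :
    ∃ (γ : ι → R) (δ : σ → R), ∀ i j, C (M i j - γ j * δ i) ∈ Ideal.span {π} := by
  classical
  choose q hq using h
  by_cases hπ : π.totalDegree = 0
  · refine ⟨0, 0, fun i j => ?_⟩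
    rw [totalDegree_eq_zero_iff_eq_C] at hπ
    have := coeff_sum_X_mul_C (M · j) i
    rw [hq, hπ, coeff_C_mul] at this
    rw [Pi.zero_apply, zero_mul, sub_zero, ← this, C_mul, ← hπ]
    exact Ideal.mem_span_singleton.2 (Dvd.intro _ rfl)
  · refine ⟨fun j => (q j).coeff 0, fun i => π.coeff (Finsupp.single i 1), fun i j => ?_⟩
    have hqj : q j = C ((q j).coeff 0) := by
      rw [← totalDegree_eq_zero_iff_eq_C]
      by_cases h0 : q j = 0
      · simp [h0]
      · have h1 := totalDegree_sum_X_mul_C_le (M · j)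
        rw [hq, totalDegree_mul_of_isDomain (by rintro rfl; simp at hπ) h0] at h1
        omega
    have := coeff_sum_X_mul_C (M · j) i
    rw [hq, hqj, mul_comm, coeff_C_mul] at this
    rw [← this, sub_self, C_0]
    exact zero_mem _

theorem Ideal.height_comap_C_span_le_one [IsNoetherianRing R] {π : MvPolynomial σ R}
    (hπ : ¬ IsUnit π) (hP : (Ideal.span {π}).IsPrime) :
    ((Ideal.span {π}).comap (C : R →+* MvPolynomial σ R)).height ≤ 1 := by
  have : (Ideal.span {π}).LiesOver ((Ideal.span {π}).comap (C : R →+* MvPolynomial σ R)) := ⟨rfl⟩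
  have h := Ideal.height_eq_height_add_of_liesOver_of_hasGoingDown
    ((Ideal.span {π}).comap (C : R →+* MvPolynomial σ R)) (Ideal.span {π})
  exact (le_self_add.trans h.ge).trans (Ideal.height_span_singleton_le_one hπ)

theorem exists_minor_notMem {A : Type*} [CommRing A] {s q t : ℕ} {M : Matrix (Fin s) (Fin q) A}
    {P : Ideal A} (h : ¬ minorsIdeal t M ≤ P) :
    ∃ (r : Fin t → Fin s) (c : Fin t → Fin q), Function.Injective c ∧
      (M.submatrix r c).det ∉ P := by
  contrapose! h
  refine Ideal.span_le.2 ?_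
  rintro _ ⟨r, c, -, hc, rfl⟩
  exact h r c hc

/-- The linear forms defining the symmetric algebra have no common prime factor. -/
theorem exists_not_dvd_of_prime [IsDomain R] [IsNoetherianRing R] {m s : ℕ}
    {Φ₁ : Matrix σ (Fin (m + 2)) R} {Φ₂ : Matrix (Fin m) (Fin (m + 2)) R}
    {φ : Matrix (Fin s) (Fin (m + 2)) R} (hφ : ∀ i, (∃ l, φ i = Φ₁ l) ∨ ∃ l, φ i = Φ₂ l)
    (h₁ : 1 < (minorsIdeal (m + 2) φ).height) (h₂ : 1 < (minorsIdeal m Φ₂).height)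
    {π : MvPolynomial σ R} (hπ : Prime π) :
    ∃ j, ¬ π ∣ ∑ l, X l * C ((Φ₁ * bbrim Φ₂) l j) := by
  by_contra! hdvd
  obtain ⟨γ, δ, hγδ⟩ := exists_rank_one_of_dvd (Φ₁ * bbrim Φ₂) hdvd
  have hspan : (Ideal.span {π}).IsPrime := (Ideal.span_singleton_prime hπ.ne_zero).2 hπ
  set P := (Ideal.span {π}).comap (C : R →+* MvPolynomial σ R)
  have hP : P.height ≤ 1 := Ideal.height_comap_C_span_le_one hπ.not_isUnit hspan
  have hnot : ∀ I : Ideal R, 1 < I.height → ¬ I ≤ P := fun I hI hle =>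
    (hI.trans_le (Ideal.height_mono hle)).not_ge hP
  obtain ⟨r, c, hc, hdet⟩ := exists_minor_notMem (hnot _ h₁)
  obtain ⟨i, j, hij⟩ := exists_bbrim_notMem (hnot _ h₂)
  let f := Ideal.Quotient.mk P
  have hzero : ∀ x, f x = 0 ↔ x ∈ P := fun x => Ideal.Quotient.eq_zero_iff_mem
  have hdet' : ((φ.map f).submatrix r c).det ≠ 0 := by
    rw [← hzero, RingHom.map_det] at hdet
    exact hdet
  refine hij ((hzero _).1 ?_)
  have key : bbrim (Φ₂.map f) = 0 := by
    refine bbrim_eq_zero_of_rank_one (Φ₁ := Φ₁.map f) (γ := f ∘ γ) (δ := f ∘ δ) ?_ ?_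
    · intro x hx₁ hx₂
      refine mulVec_eq_zero_of_minor_ne_zero hc hdet' (funext fun i => ?_)
      rcases hφ i with ⟨l, hl⟩ | ⟨l, hl⟩
      · refine Eq.trans ?_ (congrFun hx₁ l)
        simp only [Matrix.mulVec, dotProduct, Matrix.map_apply, hl]
      · refine Eq.trans ?_ (congrFun hx₂ l)
        simp only [Matrix.mulVec, dotProduct, Matrix.map_apply, hl]
    · intro i j
      rw [bbrim_map, ← Matrix.map_mul, Matrix.map_apply, Function.comp_apply,
        Function.comp_apply, ← map_mul, ← sub_eq_zero, ← map_sub, hzero]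
      exact hγδ i j
  rw [bbrim_map] at key
  exact congrFun (congrFun key i) j

end CommonFactor

/-- A nonzero ideal of a factorial ring whose elements have no common prime factor has height at
least two. -/
theorem two_le_height_of_no_common_prime {A : Type*} [CommRing A] [IsDomain A]
    [UniqueFactorizationMonoid A] {K : Ideal A} (hK : K ≠ ⊥)
    (h : ∀ π : A, Prime π → ∃ x ∈ K, ¬ π ∣ x) : 2 ≤ K.height := by
  refine Ideal.le_height_of_forall_isPrime fun P hP hKP => ?_
  have hbot : P ≠ ⊥ := fun hb => hK (le_bot_iff.1 (hb ▸ hKP))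
  obtain ⟨π, hπP, hπ⟩ := hP.exists_mem_prime_of_ne_bot hbot
  have hspan : (Ideal.span {π}).IsPrime := (Ideal.span_singleton_prime hπ.ne_zero).2 hπ
  have h₁ : (⊥ : Ideal A) < Ideal.span {π} := bot_lt_iff_ne_bot.2 fun h0 =>
    hπ.ne_zero (Ideal.span_singleton_eq_bot.1 h0)
  have h₂ : Ideal.span {π} < P := by
    refine lt_of_le_of_ne ((Ideal.span_singleton_le_iff_mem _).2 hπP) fun heq => ?_
    obtain ⟨x, hx, hdvd⟩ := h π hπ
    exact hdvd (Ideal.mem_span_singleton.1 (heq ▸ hKP hx))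
  have h₃ := Ideal.height_add_one_le_of_lt_of_isPrime h₁
  have h₄ := Ideal.height_add_one_le_of_lt_of_isPrime h₂
  calc (2 : ℕ∞) = 0 + 1 + 1 := by norm_num
    _ ≤ (Ideal.span {π}).height + 1 := by
      gcongr
      exact le_add_self.trans h₃
    _ ≤ P.height := h₄

/-- Let `φ = [Φ₁; Φ₂]` be `n×(n−1)` with `a = 3` and `ht I_{n−3}(Φ₂) = 3`,
and let `J` be generated by the 3 maximal minors of `φ` fixing the rows of `Φ₂`.  Then the
symmetric algebra `Sym_R(J)` — presented over `S = R[T₁,T₂,T₃]` by `I₁(T·Φ₁·θ)`, where `θ`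
is the Buchsbaum–Rim syzygy matrix of `Φ₂` — is Cohen–Macaulay of dimension `d+1`; indeed
`I₁(T·Φ₁·θ)` is a perfect height-2 ideal equal to the ideal of `(n−2)`-minors of the
`(n−1)×(n−2)` matrix `[(T·Φ₁)ᵗ | Φ₂ᵗ]`, whose Hilbert–Burch complex resolves it.
(Here `n = p + 3`.) -/
theorem statement9 {k : Type*} [Field k] [Infinite k] {d p : ℕ}
    (hd : 1 ≤ d) (ε₁ ε₂ : ℕ) (hε₂ : 1 ≤ ε₂) (hε : ε₂ ≤ ε₁)
    (φ : Matrix (Fin (p + 3)) (Fin (p + 2)) (MvPolynomial (Fin d) k))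
    (Φ₁ : Matrix (Fin 3) (Fin (p + 2)) (MvPolynomial (Fin d) k))
    (Φ₂ : Matrix (Fin p) (Fin (p + 2)) (MvPolynomial (Fin d) k))
    (hΦ₁ : Φ₁ = φ.submatrix (fun i : Fin 3 =>
      (⟨(i : ℕ), by have := i.isLt; omega⟩ : Fin (p + 3))) id)
    (hΦ₂ : Φ₂ = φ.submatrix (fun i : Fin p =>
      (⟨3 + (i : ℕ), by have := i.isLt; omega⟩ : Fin (p + 3))) id)
    (hdeg₁ : ∀ i j, (Φ₁ i j).IsHomogeneous ε₁)
    (hdeg₂ : ∀ i j, (Φ₂ i j).IsHomogeneous ε₂)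
    (hI : idealHeight (minorsIdeal (p + 2) φ) = 2)
    (hht : idealHeight (minorsIdeal p Φ₂) = 3)
    (v : Fin (p + 2) → MvPolynomial (Fin 3) (MvPolynomial (Fin d) k))
    (hv : v = fun j => ∑ i : Fin 3,
      MvPolynomial.X i * MvPolynomial.C ((Φ₁ * bbrim Φ₂) i j))
    (K : Ideal (MvPolynomial (Fin 3) (MvPolynomial (Fin d) k)))
    (hK : K = Ideal.span (Set.range v))
    (B : Matrix (Fin (p + 2)) (Fin (p + 1)) (MvPolynomial (Fin 3) (MvPolynomial (Fin d) k)))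
    (hB : B = Matrix.of fun r c => Fin.cases
      (∑ i : Fin 3, MvPolynomial.X i * MvPolynomial.C (Φ₁ i r))
      (fun c' => MvPolynomial.C (Φ₂ c' r)) c) :
    K = minorsIdeal (p + 1) B ∧
    idealHeight K = 2 ∧
    IsCohenMacaulayRing (MvPolynomial (Fin 3) (MvPolynomial (Fin d) k) ⧸ K) ∧
    ringKrullDim (MvPolynomial (Fin 3) (MvPolynomial (Fin d) k) ⧸ K) =
      ((d + 1 : ℕ) : WithBot ℕ∞) ∧
    Function.Injective B.mulVecLin ∧
    LinearMap.range B.mulVecLin = LinearMap.ker (rowMap v) := by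
  have h₁ : 1 < (minorsIdeal (p + 2) φ).height := by
    rw [← idealHeight_eq_height, hI]; norm_num
  have h₂ : 1 < (minorsIdeal p Φ₂).height := by
    rw [← idealHeight_eq_height, hht]; norm_num
  have hrows : ∀ i, (∃ l, φ i = Φ₁ l) ∨ ∃ l, φ i = Φ₂ l := by
    intro i
    rcases lt_or_ge (i : ℕ) 3 with h | h
    · exact Or.inl ⟨⟨i, h⟩, by rw [hΦ₁]; rfl⟩
    · refine Or.inr ⟨⟨i - 3, by omega⟩, ?_⟩
      rw [hΦ₂]
      exact congrArg φ (Fin.ext (by simp only; omega))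
  have hvB : v = signedMinors B := by
    let a : Fin (p + 2) → MvPolynomial (Fin 3) (MvPolynomial (Fin d) k) :=
      fun r => ∑ i : Fin 3, X i * C (Φ₁ i r)
    have hBt : B = (Matrix.of (Fin.cons a (Φ₂.map C) :
        Fin (p + 1) → Fin (p + 2) → MvPolynomial (Fin 3) (MvPolynomial (Fin d) k)))ᵀ := by
      rw [hB]
      ext r c : 2
      refine Fin.cases ?_ (fun c' => ?_) c <;> rfl
    rw [hBt, hv]
    ext j : 1
    rw [signedMinors_transpose_cons, bbrim_map]
    simp only [a, Matrix.mul_apply, map_sum, map_mul, Matrix.map_apply, Finset.mul_sum,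
      Finset.sum_mul, mul_assoc]
    exact Finset.sum_comm
  have hprime : ∀ π, Prime π → ∃ j, ¬ π ∣ signedMinors B j := fun π hπ => by
    rw [← hvB, hv]
    exact exists_not_dvd_of_prime hrows h₁ h₂ hπ
  obtain ⟨j, hj⟩ : ∃ j, signedMinors B j ≠ 0 := by
    obtain ⟨j, hj⟩ := hprime (X 0) X_prime
    exact ⟨j, fun h => hj (h ▸ dvd_zero _)⟩
  have hinj := mulVecLin_injective_of_signedMinors_ne_zero B hj
  have hexact := range_mulVecLin_eq_ker_rowMap B hj hprime
  rw [← hvB] at hexact hj hprime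
  have hKminors : K = minorsIdeal (p + 1) B := by
    rw [hK, hvB, minorsIdeal_eq_span_signedMinors]
  have hmem : ∀ j, v j ∈ K := fun j => hK ▸ Ideal.subset_span ⟨j, rfl⟩
  have hKbot : K ≠ ⊥ := fun h => hj (by simpa [h] using hmem j)
  have hKtop : K ≠ ⊤ := by
    have hle : K ≤ RingHom.ker (constantCoeff :
        MvPolynomial (Fin 3) (MvPolynomial (Fin d) k) →+* MvPolynomial (Fin d) k) := by
      rw [hK, Ideal.span_le]
      rintro _ ⟨j, rfl⟩
      simp [hv, RingHom.mem_ker]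
    exact fun h => RingHom.ker_ne_top _ (top_le_iff.1 (h ▸ hle))
  have hht2 : 2 ≤ K.height := two_le_height_of_no_common_prime hKbot fun π hπ => by
    obtain ⟨j, hj⟩ := hprime π hπ
    exact ⟨v j, hmem j, hj⟩
  have hreg : HasMaximalRegularSequences (MvPolynomial (Fin 3) (MvPolynomial (Fin d) k))
      (d + 1 + 2) := by
    have := ((HasMaximalRegularSequences.of_field k).mvPolynomial d).mvPolynomial 3
    rwa [zero_add] at this
  have hdim : ringKrullDim (MvPolynomial (Fin 3) (MvPolynomial (Fin d) k)) =
      ((d + 1 + 2 : ℕ) : WithBot ℕ∞) := by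
    rw [MvPolynomial.ringKrullDim_of_isNoetherianRing,
      MvPolynomial.ringKrullDim_of_isNoetherianRing,
      ringKrullDim_eq_zero_of_field, zero_add, Nat.card_fin, Nat.card_fin]
    rfl
  obtain ⟨hheight, hCM, hdimK⟩ := isCohenMacaulayRing_quotient_of_free_resolution hreg
    hdim hKtop hht2 B.mulVecLin (rowMap v) hinj hexact (by rw [range_rowMap, hK])
  exact ⟨hKminors, by rw [idealHeight_eq_height, hheight], hCM, hdimK, hinj, hexact⟩
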